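/- Let d ≥ 2 be an integer and p ∈ ℝ. The conical Radon transform is injective on smooth compactly supported functions: if f : ℝ^{d-1} × ℝ → ℝ is smooth with compact support contained in ℝ^{d-1} × (0,∞) and (R^(p) f)(u, θ) = 0 for all u ∈ ℝ^{d-1} and all θ ∈ (0, π/2), then f = 0. -/

import Mathlib

open MeasureTheory Real Metric
open scoped RealInnerProductSpace

noncomputable section

/-- The standard surface measure on the unit sphere `S^{d-2} ⊆ ℝ^{d-1}`
(for `d = 2` this is the counting measure on `S^0 = {±1}`). -/
def sphereMeasure (d : ℕ) : Measure (sphere (0 : EuclideanSpace ℝ (Fin (d - 1))) 1) :=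
  (volume : Measure (EuclideanSpace ℝ (Fin (d - 1)))).toSphere

/-- The conical Radon transform with radial weight `1/s^p`:
`(R^(p) f)(u, θ) = ∫_0^∞ s^(-p) ∫_{S^{d-2}} f(u + s sin θ n, s cos θ) (s sin θ)^(d-2) dn ds`. -/
def coneRadon (d : ℕ) (p : ℝ) (f : EuclideanSpace ℝ (Fin (d - 1)) × ℝ → ℝ)
    (u : EuclideanSpace ℝ (Fin (d - 1))) (θ : ℝ) : ℝ :=
  ∫ s in Set.Ioi (0 : ℝ),
    s ^ (-p) *
      ∫ n, f (u + (s * Real.sin θ) • (n : EuclideanSpace ℝ (Fin (d - 1))), s * Real.cos θ) *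
          (s * Real.sin θ) ^ (d - 2) ∂(sphereMeasure d)

/-- Fourier transform in the first argument:
`(F g)(k, θ) = ∫_{ℝ^{d-1}} e^{-i⟨k,u⟩} g(u, θ) du`. -/
def fourierFirst (d : ℕ) (g : EuclideanSpace ℝ (Fin (d - 1)) → ℝ → ℝ)
    (k : EuclideanSpace ℝ (Fin (d - 1))) (θ : ℝ) : ℂ :=
  ∫ u, Complex.exp (-Complex.I * (⟪k, u⟫ : ℝ)) * (g u θ : ℂ)

/-- The Riesz-filtered data
`g(u, θ) = (2π)^(1-d) ∫_{ℝ^{d-1}} |k|^(d-1) (F R^(p) f)(k, θ) e^{i⟨k,u⟩} dk`. -/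
def filteredData (d : ℕ) (p : ℝ) (f : EuclideanSpace ℝ (Fin (d - 1)) × ℝ → ℝ)
    (u : EuclideanSpace ℝ (Fin (d - 1))) (θ : ℝ) : ℂ :=
  (((2 * π) ^ ((1 : ℤ) - (d : ℤ)) : ℝ) : ℂ) *
    ∫ k, ((‖k‖ ^ (d - 1) : ℝ) : ℂ) * fourierFirst d (coneRadon d p f) k θ *
      Complex.exp (Complex.I * (⟪k, u⟫ : ℝ))

theorem eq_zero_of_integral_mul_gaussian_eq_zero {h : ℝ → ℝ} (hc : Continuous h)
    (hs : HasCompactSupport h) (h0 : ∀ z ≤ 0, h z = 0)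
    (hi : ∀ n : ℕ, ∫ z, h z * exp (-z ^ 2) ^ (n + 1) = 0) : h = 0 := by
  obtain ⟨b, hb⟩ : ∃ b : ℝ, ∀ z, b < z → h z = 0 := by
    obtain ⟨b, hb⟩ := hs.isCompact.bddAbove
    exact ⟨b, fun z hz => image_eq_zero_of_notMem_tsupport fun hm => (hb hm).not_gt hz⟩
  have hint : Integrable h := hc.integrable_of_hasCompactSupport hs
  have hpoly : ∀ P : Polynomial ℝ, ∫ z, h z * (exp (-z ^ 2) * P.eval (exp (-z ^ 2))) = 0 := by
    intro P
    have : ∀ z, h z * (exp (-z ^ 2) * P.eval (exp (-z ^ 2))) =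
        ∑ i ∈ Finset.range (P.natDegree + 1), P.coeff i * (h z * exp (-z ^ 2) ^ (i + 1)) := by
      intro z
      rw [Polynomial.eval_eq_sum_range, Finset.mul_sum, Finset.mul_sum]
      exact Finset.sum_congr rfl fun i _ => by ring
    simp_rw [this]
    rw [integral_finsetSum]
    · simp [integral_const_mul, hi]
    · intro i _
      refine Integrable.const_mul (Continuous.integrable_of_hasCompactSupport (by fun_prop)
        hs.mul_right) _
  have key : ∀ ε > 0, ∫ z, h z * h z ≤ ε * ∫ z, |h z| := by
    intro ε hε
    obtain ⟨P, hP⟩ := exists_polynomial_near_of_continuousOn (exp (-b ^ 2)) 1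
      (fun w => h (√(-log w)) / w) (by
        refine ContinuousOn.div (hc.comp_continuousOn (ContinuousOn.sqrt (ContinuousOn.neg
          (continuousOn_id.log ?_)))) continuousOn_id ?_ <;>
        exact fun x hx => ((exp_pos _).trans_le hx.1).ne') ε hε
    have hI : Integrable fun z => h z * (exp (-z ^ 2) * P.eval (exp (-z ^ 2))) :=
      Continuous.integrable_of_hasCompactSupport (by fun_prop) hs.mul_right
    have hI2 : Integrable fun z => h z * h z :=
      Continuous.integrable_of_hasCompactSupport (by fun_prop) hs.mul_right
    calc ∫ z, h z * h z
        = ∫ z, (h z * h z - h z * (exp (-z ^ 2) * P.eval (exp (-z ^ 2)))) := by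
          rw [integral_sub hI2 hI, hpoly, sub_zero]
      _ ≤ ∫ z, ε * |h z| := by
          refine integral_mono (hI2.sub hI) (hint.abs.const_mul ε) fun z => ?_
          rcases le_or_gt z 0 with hz | hz
          · simp [h0 z hz]
          rcases lt_or_ge b z with hz' | hz'
          · simp [hb z hz']
          have hw := hP (exp (-z ^ 2)) ⟨by gcongr, by simp; positivity⟩
          have hE := exp_pos (-z ^ 2)
          have hE1 : exp (-z ^ 2) ≤ 1 := by simp; positivity
          simp only [log_exp, neg_neg, sqrt_sq hz.le] at hw
          have : h z * h z - h z * (exp (-z ^ 2) * P.eval (exp (-z ^ 2))) =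
            -(h z * exp (-z ^ 2) * (P.eval (exp (-z ^ 2)) - h z / exp (-z ^ 2))) := by
            field_simp
            ring
          calc _ = _ := this
            _ ≤ |_| := neg_le_abs _
            _ = |h z| * (exp (-z ^ 2) * |P.eval (exp (-z ^ 2)) - h z / exp (-z ^ 2)|) := by
              rw [abs_mul, abs_mul, abs_of_pos hE, mul_assoc]
            _ ≤ |h z| * (1 * ε) := by gcongr
            _ = ε * |h z| := by ring
      _ = ε * ∫ z, |h z| := integral_const_mul _ _
  have hzero : ∫ z, h z * h z = 0 := by
    refine le_antisymm (le_of_forall_pos_le_add fun δ hδ => ?_)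
      (integral_nonneg fun z => mul_self_nonneg _)
    have hA : 0 ≤ ∫ z, |h z| := integral_nonneg fun z => abs_nonneg _
    refine (key (δ / (1 + ∫ z, |h z|)) (by positivity)).trans ?_
    rw [zero_add, div_mul_eq_mul_div, div_le_iff₀ (by positivity)]
    nlinarith
  rw [integral_eq_zero_iff_of_nonneg (fun z => mul_self_nonneg _)
    ((hc.mul hc).integrable_of_hasCompactSupport hs.mul_right)] at hzero
  replace hzero := (hc.mul hc).ae_eq_iff_eq volume continuous_zero |>.1 hzero
  funext z
  simpa using congrFun hzero z

theorem eq_zero_of_integral_gaussian_mul_eq_zero {h : ℝ → ℂ} (hc : Continuous h)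
    (hs : HasCompactSupport h) (h0 : ∀ z ≤ 0, h z = 0)
    (hi : ∀ c : ℝ, 0 < c → ∫ z, Complex.exp (-(c * z ^ 2 : ℝ)) * h z = 0) : h = 0 := by
  have hi' : ∀ n : ℕ, ∫ z, ((exp (-z ^ 2) ^ (n + 1) : ℝ) : ℂ) * h z = 0 := by
    intro n
    rw [← hi (n + 1) (by positivity)]
    refine integral_congr_ae (.of_forall fun z => ?_)
    dsimp only
    rw [← exp_nat_mul, Complex.ofReal_exp]
    push_cast
    ring_nf
  have hI : ∀ n : ℕ, Integrable fun z => ((exp (-z ^ 2) ^ (n + 1) : ℝ) : ℂ) * h z := fun n =>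
    Continuous.integrable_of_hasCompactSupport (by fun_prop) hs.mul_left
  have hre : (fun z => (h z).re) = 0 := by
    refine eq_zero_of_integral_mul_gaussian_eq_zero (by fun_prop)
      (hs.comp_left Complex.zero_re) (fun z hz => by simp [h0 z hz]) fun n => ?_
    have := Complex.reCLM.integral_comp_comm (hI n)
    rw [hi', map_zero] at this
    rw [← this]
    refine integral_congr_ae (.of_forall fun z => ?_)
    simp only [Complex.reCLM_apply, Complex.re_ofReal_mul]
    exact mul_comm _ _
  have him : (fun z => (h z).im) = 0 := by
    refine eq_zero_of_integral_mul_gaussian_eq_zero (by fun_prop)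
      (hs.comp_left Complex.zero_im) (fun z hz => by simp [h0 z hz]) fun n => ?_
    have := Complex.imCLM.integral_comp_comm (hI n)
    rw [hi', map_zero] at this
    rw [← this]
    refine integral_congr_ae (.of_forall fun z => ?_)
    simp only [Complex.imCLM_apply, Complex.im_ofReal_mul]
    exact mul_comm _ _
  funext z
  exact Complex.ext (congrFun hre z) (congrFun him z)

section PartialFourier

variable {E : Type*} [NormedAddCommGroup E] [InnerProductSpace ℝ E] [FiniteDimensional ℝ E]
  [MeasurableSpace E] [BorelSpace E]

theorem integral_eq_zero_of_spherical_integrals_eq_zero [Nontrivial E] {g : E → ℂ}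
    (hg : Integrable g)
    (h : ∀ t : ℝ, 0 < t → ∫ n : sphere (0 : E) 1, g (t • (n : E))
      ∂(volume : Measure E).toSphere = 0) :
    ∫ y, g y = 0 := by
  have hmp := (volume : Measure E).measurePreserving_homeomorphUnitSphereProd.symm
    (homeomorphUnitSphereProd E).toMeasurableEquiv
  have hemb := (homeomorphUnitSphereProd E).symm.measurableEmbedding
  have h1 : ∫ y, g y = ∫ x : ({0}ᶜ : Set E), g x ∂(volume.comap Subtype.val) := by
    rw [integral_subtype_comap (measurableSet_singleton _).compl g,
        restrict_compl_singleton]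
  have hgi : Integrable (fun x : ({0}ᶜ : Set E) => g x) (volume.comap Subtype.val) := by
    have := (integrableOn_iff_comap_subtypeVal (μ := volume) (f := g)
      (measurableSet_singleton (0 : E)).compl).1 hg.integrableOn
    exact this
  have h2 := hmp.integral_comp hemb (fun x : ({0}ᶜ : Set E) => g x)
  have h3 := (hmp.integrable_comp_emb hemb (g := fun x : ({0}ᶜ : Set E) => g x)).2 hgi
  rw [h1, ← h2]
  refine (integral_prod_symm _ h3).trans ?_
  refine integral_eq_zero_of_ae (.of_forall fun r => ?_)
  exact h r r.2

theorem eq_zero_of_fourier_eq_zero [Nontrivial E] {g : E → ℂ} (hc : Continuous g)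
    (hs : HasCompactSupport g)
    (h : ∀ k : E, k ≠ 0 → ∫ v, Complex.exp (-(⟪k, v⟫ : ℝ) * Complex.I) * g v = 0) : g = 0 := by
  have hi : Integrable g := hc.integrable_of_hasCompactSupport hs
  have h1 : ∀ k : E, k ≠ 0 → FourierTransform.fourier g k = 0 := by
    intro k hk
    rw [Real.fourier_eq']
    rw [← h ((2 * π) • k) (smul_ne_zero (by positivity) hk)]
    refine integral_congr_ae (.of_forall fun v => ?_)
    simp only [smul_eq_mul, real_inner_smul_left, real_inner_comm k v]
    push_cast
    ring_nf
  have hcont : Continuous (FourierTransform.fourier g) :=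
    VectorFourier.fourierIntegral_continuous Real.continuous_fourierChar
      (by exact continuous_inner) hi
  have h2 : FourierTransform.fourier g = 0 := by
    refine Continuous.ext_on (dense_compl_singleton (0 : E)) hcont continuous_zero ?_
    exact fun k hk => h1 k hk
  have := hc.fourierInv_fourier_eq hi (by rw [h2]; exact integrable_zero _ _ _)
  rw [← this, h2]
  funext v
  simp [Real.fourierInv_eq']

/-- The Fourier transform of `F` in its first variable, without the factor `2π` in the phase. -/
def partialFourier (F : E × ℝ → ℝ) (k : E) (z : ℝ) : ℂ :=
  ∫ u, Complex.exp (-(⟪k, u⟫ : ℝ) * Complex.I) * (F (u, z) : ℂ)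

theorem continuous_partialFourier {F : E × ℝ → ℝ} (hc : Continuous F) (hs : HasCompactSupport F)
    (k : E) : Continuous (partialFourier F k) := by
  have hK : IsCompact (Prod.fst '' tsupport F) := hs.isCompact.image continuous_fst
  have : partialFourier F k = fun z => ∫ u in Prod.fst '' tsupport F,
      Complex.exp (-(⟪k, u⟫ : ℝ) * Complex.I) * (F (u, z) : ℂ) := by
    funext z
    refine (setIntegral_eq_integral_of_forall_compl_eq_zero fun u hu => ?_).symm
    rw [image_eq_zero_of_notMem_tsupport fun h => hu ⟨_, h, rfl⟩]
    simp
  rw [this]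
  exact continuous_parametric_integral_of_continuous (by fun_prop) hK

theorem hasCompactSupport_partialFourier {F : E × ℝ → ℝ} (hs : HasCompactSupport F) (k : E) :
    HasCompactSupport (partialFourier F k) := by
  refine .intro (hs.isCompact.image continuous_snd) fun z hz => ?_
  have (u : E) : F (u, z) = 0 := image_eq_zero_of_notMem_tsupport fun h => hz ⟨_, h, rfl⟩
  simp [partialFourier, this]

theorem integral_sphere_partialFourier_eq_zero {F : E × ℝ → ℝ} (hc : Continuous F)
    (hs : HasCompactSupport F) {t : ℝ}
    (h : ∀ u : E, ∫ z, ∫ n : sphere (0 : E) 1, F (u + (z * t) • (n : E), z)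
      ∂(volume : Measure E).toSphere = 0) (k : E) :
    ∫ n : sphere (0 : E) 1, (∫ z : ℝ, Complex.exp ((⟪k, (z * t) • (n : E)⟫ : ℝ) * Complex.I) *
      partialFourier F k z) ∂(volume : Measure E).toSphere = 0 := by
  set σ := (volume : Measure E).toSphere with hσ
  let K : E × (ℝ × sphere (0 : E) 1) → ℂ := fun x =>
    Complex.exp (-(⟪k, x.1⟫ : ℝ) * Complex.I) * (F (x.1 + (x.2.1 * t) • (x.2.2 : E), x.2.1) : ℂ)
  have hKc : Continuous K := by fun_prop
  have hKs : HasCompactSupport K := by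
    have hcomp : IsCompact ((fun x : (E × ℝ) × sphere (0 : E) 1 =>
        (x.1.1 - (x.1.2 * t) • (x.2 : E), (x.1.2, x.2))) '' (tsupport F ×ˢ Set.univ)) :=
      (hs.isCompact.prod isCompact_univ).image (by fun_prop)
    refine .intro hcomp fun x hx => ?_
    have : F (x.1 + (x.2.1 * t) • (x.2.2 : E), x.2.1) = 0 := by
      refine image_eq_zero_of_notMem_tsupport fun hm => hx ?_
      exact ⟨((x.1 + (x.2.1 * t) • (x.2.2 : E), x.2.1), x.2.2), ⟨hm, Set.mem_univ _⟩, by simp⟩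
    simp [K, this]
  have hKi : Integrable K (volume.prod (volume.prod σ)) :=
    hKc.integrable_of_hasCompactSupport hKs
  have h1 : ∫ x, K x ∂(volume.prod (volume.prod σ)) = 0 := by
    rw [integral_prod _ hKi]
    refine integral_eq_zero_of_ae (.of_forall fun u => ?_)
    have hi : Integrable (fun q : ℝ × sphere (0 : E) 1 => F (u + (q.1 * t) • (q.2 : E), q.1))
        (volume.prod σ) := by
      refine Continuous.integrable_of_hasCompactSupport (by fun_prop)
        (.intro ((hs.isCompact.image continuous_snd).prod isCompact_univ) fun q hq => ?_)
      exact image_eq_zero_of_notMem_tsupport fun hm => hq ⟨⟨_, hm, rfl⟩, Set.mem_univ _⟩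
    simp only [K, Pi.zero_apply]
    rw [integral_const_mul, integral_complex_ofReal, integral_prod _ hi, h u]
    simp
  rw [integral_prod_symm _ hKi, integral_prod_symm _ hKi.integral_prod_right] at h1
  rw [← h1]
  refine integral_congr_ae (.of_forall fun n => integral_congr_ae (.of_forall fun z => ?_))
  simp only [K, partialFourier]
  rw [← integral_const_mul, ← integral_add_right_eq_self _ ((z * t) • (n : E))]
  refine integral_congr_ae (.of_forall fun u => ?_)
  simp only [← mul_assoc, ← Complex.exp_add, inner_add_right]
  congr 2
  push_cast
  ring

theorem eq_zero_of_conical_integrals_eq_zero [Nontrivial E] {F : E × ℝ → ℝ} (hc : Continuous F)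
    (hs : HasCompactSupport F) (hF : ∀ u, ∀ z ≤ 0, F (u, z) = 0)
    (h : ∀ t : ℝ, 0 < t → ∀ u : E, ∫ z, ∫ n : sphere (0 : E) 1, F (u + (z * t) • (n : E), z)
      ∂(volume : Measure E).toSphere = 0) : F = 0 := by
  have key : ∀ k : E, k ≠ 0 → partialFourier F k = 0 := by
    intro k hk
    have hk' : 0 < ‖k‖ := norm_pos_iff.2 hk
    have hHc := continuous_partialFourier hc hs k
    have hHs := hasCompactSupport_partialFourier hs k
    refine eq_zero_of_integral_gaussian_mul_eq_zero hHc hHs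
      (fun z hz => by simp [partialFourier, hF _ z hz]) fun c hc0 => ?_
    set a : ℝ := ‖k‖ ^ 2 / (4 * c) with ha
    have ha0 : 0 < a := by positivity
    let K : E × ℝ → ℂ := fun x =>
      Complex.exp (-(a : ℂ) * ‖x.1‖ ^ 2 + (x.2 * Complex.I) * (⟪k, x.1⟫ : ℝ)) *
        partialFourier F k x.2
    have hKi : Integrable K (volume.prod volume) := by
      have hg := GaussianFourier.integrable_cexp_neg_mul_sq_norm_add (V := E) (b := a)
        (by simpa using ha0) 0 k
      refine (hg.mul_prod (hHc.integrable_of_hasCompactSupport hHs)).mono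
        (by fun_prop) (.of_forall fun x => le_of_eq ?_)
      simp [K, Complex.norm_exp, ← Complex.ofReal_pow]
    have h1 : ∫ y, ∫ z, K (y, z) = 0 := by
      refine integral_eq_zero_of_spherical_integrals_eq_zero hKi.integral_prod_left fun t ht => ?_
      have h2 := integral_sphere_partialFourier_eq_zero hc hs (h t ht) k
      rw [← mul_zero (Complex.exp (-(a : ℂ) * t ^ 2)), ← h2, ← integral_const_mul]
      refine integral_congr_ae (.of_forall fun n => ?_)
      dsimp only
      rw [← integral_const_mul]
      refine integral_congr_ae (.of_forall fun z => ?_)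
      simp only [K, ← mul_assoc, ← Complex.exp_add, norm_smul, norm_eq_of_mem_sphere,
        real_inner_smul_right, Real.norm_eq_abs, abs_of_pos ht]
      congr 2
      push_cast
      ring
    rw [integral_integral_swap hKi] at h1
    have h3 : ∀ z : ℝ, ∫ y, K (y, z) = (π / a : ℂ) ^ (Module.finrank ℝ E / 2 : ℂ) *
        (Complex.exp (-(c * z ^ 2 : ℝ)) * partialFourier F k z) := by
      intro z
      simp only [K]
      rw [integral_mul_const, GaussianFourier.integral_cexp_neg_mul_sq_norm_add (by simpa using ha0),
        mul_assoc]
      congr 3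
      have : (‖k‖ : ℂ) ≠ 0 := by exact_mod_cast hk'.ne'
      have : (c : ℂ) ≠ 0 := by exact_mod_cast hc0.ne'
      rw [ha, mul_pow, Complex.I_sq]
      push_cast
      field_simp
    simp_rw [h3] at h1
    rw [integral_const_mul] at h1
    refine (mul_eq_zero.1 h1).resolve_left ?_
    have : (π / a : ℂ) ≠ 0 := by exact_mod_cast (div_pos pi_pos ha0).ne'
    simp [Complex.cpow_eq_zero_iff, this]
  funext ⟨u, z⟩
  have := eq_zero_of_fourier_eq_zero (g := fun v : E => (F (v, z) : ℂ)) (by fun_prop)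
    (.intro (hs.isCompact.image continuous_fst) fun v hv => by
      rw [image_eq_zero_of_notMem_tsupport fun hm => hv ⟨_, hm, rfl⟩, Complex.ofReal_zero])
    (fun k hk => congrFun (key k hk) z)
  simpa using congrFun this u

end PartialFourier

theorem continuous_rpow_snd_mul {X : Type*} [TopologicalSpace X] {f : X × ℝ → ℝ}
    (hf : Continuous f) (hfs : tsupport f ⊆ {q : X × ℝ | 0 < q.2}) (r : ℝ) :
    Continuous fun q : X × ℝ => q.2 ^ r * f q := by
  rw [continuous_iff_continuousAt]
  intro q
  by_cases hq : 0 < q.2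
  · exact (continuousAt_snd.rpow_const (.inl hq.ne')).mul hf.continuousAt
  · have h0 : f =ᶠ[nhds q] 0 := notMem_tsupport_iff_eventuallyEq.1 fun h => hq (hfs h)
    refine continuousAt_const (y := (0 : ℝ)) |>.congr ?_
    filter_upwards [h0] with x hx
    simp [hx]

theorem coneRadon_arctan (d : ℕ) (p : ℝ) (f : EuclideanSpace ℝ (Fin (d - 1)) × ℝ → ℝ)
    (u : EuclideanSpace ℝ (Fin (d - 1))) (t : ℝ) :
    coneRadon d p f u (arctan t) = √(1 + t ^ 2) * (√(1 + t ^ 2) ^ (-p) * t ^ (d - 2)) *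
      ∫ z in Set.Ioi (0 : ℝ), ∫ n, z ^ (d - 2) * (z ^ (-p) *
        f (u + (z * t) • (n : EuclideanSpace ℝ (Fin (d - 1))), z)) ∂(sphereMeasure d) := by
  set c : ℝ := √(1 + t ^ 2) with hc
  have hc0 : 0 < c := by positivity
  have h := integral_comp_mul_left_Ioi (E := ℝ) (fun s : ℝ => s ^ (-p) *
      ∫ n, f (u + (s * Real.sin (arctan t)) • (n : EuclideanSpace ℝ (Fin (d - 1))),
        s * Real.cos (arctan t)) * (s * Real.sin (arctan t)) ^ (d - 2) ∂(sphereMeasure d)) 0 hc0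
  rw [mul_zero, smul_eq_mul, eq_inv_mul_iff_mul_eq₀ hc0.ne'] at h
  rw [coneRadon, ← h, mul_assoc c]
  congr 1
  rw [← integral_const_mul]
  refine setIntegral_congr_fun measurableSet_Ioi fun z (hz : 0 < z) => ?_
  have hsin : c * z * Real.sin (arctan t) = z * t := by
    rw [sin_arctan, ← hc]
    field_simp
  have hcos : c * z * Real.cos (arctan t) = z := by
    rw [cos_arctan, ← hc]
    field_simp
  simp only [hsin, hcos]
  rw [← integral_const_mul, ← integral_const_mul, mul_rpow hc0.le hz.le]
  refine integral_congr_ae (.of_forall fun n => ?_)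
  dsimp only
  rw [mul_pow]
  ring

/-- the conical Radon transform is injective on smooth functions with compact
support in `ℝ^{d-1} × (0,∞)`. -/
theorem coneRadon_injective (d : ℕ) (hd : 2 ≤ d) (p : ℝ)
    (f : EuclideanSpace ℝ (Fin (d - 1)) × ℝ → ℝ)
    (hf : ContDiff ℝ (⊤ : ℕ∞) f) (hfc : HasCompactSupport f)
    (hfs : tsupport f ⊆ {q : EuclideanSpace ℝ (Fin (d - 1)) × ℝ | 0 < q.2})
    (h0 : ∀ u : EuclideanSpace ℝ (Fin (d - 1)), ∀ θ ∈ Set.Ioo (0 : ℝ) (π / 2),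
      coneRadon d p f u θ = 0) :
    f = 0 := by
  have hsupp : ∀ u, ∀ z ≤ 0, f (u, z) = 0 := fun u z hz =>
    image_eq_zero_of_notMem_tsupport fun h => (hfs h).not_ge hz
  let F : EuclideanSpace ℝ (Fin (d - 1)) × ℝ → ℝ := fun q => q.2 ^ (d - 2) * (q.2 ^ (-p) * f q)
  have hFc : Continuous F :=
    (continuous_snd.pow _).mul (continuous_rpow_snd_mul hf.continuous hfs (-p))
  have hFs : HasCompactSupport F := by
    refine .intro hfc.isCompact fun q hq => ?_
    simp [F, image_eq_zero_of_notMem_tsupport hq]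
  have : Nonempty (Fin (d - 1)) := ⟨⟨0, by omega⟩⟩
  have hF : F = 0 := by
    refine eq_zero_of_conical_integrals_eq_zero hFc hFs (fun u z hz => by simp [F, hsupp u z hz])
      fun t ht u => ?_
    have h1 := h0 u (arctan t) ⟨arctan_pos.2 ht, arctan_lt_pi_div_two t⟩
    rw [coneRadon_arctan] at h1
    rw [← setIntegral_eq_integral_of_forall_compl_eq_zero (s := Set.Ioi (0 : ℝ))]
    · refine (mul_eq_zero.1 h1).resolve_left ?_
      positivity
    · intro z hz
      simp [F, hsupp _ z (not_lt.1 hz)]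
  funext q
  by_cases hq : 0 < q.2
  · have := congrFun hF q
    simpa [F, hq.ne', (rpow_pos_of_pos hq _).ne'] using this
  · exact hsupp q.1 q.2 (not_lt.1 hq)

end
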